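/- Let F be a Minkowski norm on a finite-dimensional real vector space V, and define the Legendre transformation L : V → V* by L(y) = g_y(y,·) for y ≠ 0 and L(0)=0. Then for every nonzero covector ξ ∈ V* there exists a unique nonzero y ∈ V with L(y) = ξ; i.e., L is a bijection from V∖{0} onto V*∖{0}. -/

import Mathlib

open Set

/-- Half the second derivative of `F²` at base point `y`, i.e. the fundamental form `g_y(u,v)`. -/
noncomputable def fundForm {V : Type*} [NormedAddCommGroup V] [NormedSpace ℝ V]
    (F : V → ℝ) (y u v : V) : ℝ :=
  (1 / 2) * fderiv ℝ (fun z => fderiv ℝ (fun w => (F w) ^ 2) z u) y v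


section helpers
variable {V : Type*} [NormedAddCommGroup V] [NormedSpace ℝ V]

lemma sq_contDiffAt (F : V → ℝ) (hF_smooth : ContDiffOn ℝ (⊤ : ℕ∞) F {0}ᶜ) (y : V) (hy : y ≠ 0) :
    ContDiffAt ℝ 2 (fun w => (F w) ^ 2) y := by
  have h := (hF_smooth.contDiffAt (isOpen_compl_singleton.mem_nhds hy)).pow 2
  exact h.of_le (WithTop.coe_le_coe.2 (le_top : ((2 : ℕ∞)) ≤ ⊤))

lemma sq_diff (F : V → ℝ) (hF_smooth : ContDiffOn ℝ (⊤ : ℕ∞) F {0}ᶜ) (y : V) (hy : y ≠ 0) :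
    DifferentiableAt ℝ (fun w => (F w) ^ 2) y :=
  (sq_contDiffAt F hF_smooth y hy).differentiableAt (by norm_num)

lemma sq_diff2 (F : V → ℝ) (hF_smooth : ContDiffOn ℝ (⊤ : ℕ∞) F {0}ᶜ) (y : V) (hy : y ≠ 0) :
    DifferentiableAt ℝ (fderiv ℝ (fun w => (F w) ^ 2)) y :=
  ((sq_contDiffAt F hF_smooth y hy).fderiv_right (m := 1) (by norm_num)).differentiableAt
    (by norm_num)

lemma euler_id (F : V → ℝ) (hF_smooth : ContDiffOn ℝ (⊤ : ℕ∞) F {0}ᶜ)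
    (hF_hom : ∀ (c : ℝ), 0 < c → ∀ y, F (c • y) = c * F y) (y : V) (hy : y ≠ 0) :
    fderiv ℝ (fun w => (F w) ^ 2) y y = 2 * F y ^ 2 := by
  have h1 : HasDerivAt (fun t : ℝ => t • y) y 1 := by
    simpa using (hasDerivAt_id (1 : ℝ)).smul_const y
  have h2 : HasFDerivAt (fun w => (F w) ^ 2) (fderiv ℝ (fun w => (F w) ^ 2) y) ((1 : ℝ) • y) := by
    rw [one_smul]; exact (sq_diff F hF_smooth y hy).hasFDerivAt
  have h3 := h2.comp_hasDerivAt (1 : ℝ) h1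
  have h4 : HasDerivAt (fun t : ℝ => t ^ 2 * F y ^ 2) (2 * F y ^ 2) 1 := by
    simpa using (hasDerivAt_pow 2 (1 : ℝ)).mul_const (F y ^ 2)
  refine h3.unique (h4.congr_of_eventuallyEq ?_)
  filter_upwards [lt_mem_nhds (zero_lt_one (α := ℝ))] with t ht
  simp only [Function.comp, hF_hom t ht]
  ring

lemma fundForm_eq (F : V → ℝ) (hF_smooth : ContDiffOn ℝ (⊤ : ℕ∞) F {0}ᶜ)
    (y : V) (hy : y ≠ 0) (u v : V) :
    fundForm F y u v = (1 / 2) * fderiv ℝ (fderiv ℝ (fun w => (F w) ^ 2)) y v u := by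
  unfold fundForm
  have := ((sq_diff2 F hF_smooth y hy).hasFDerivAt.clm_apply (hasFDerivAt_const u y)).fderiv
  rw [this]; simp

lemma fundForm_self (F : V → ℝ) (hF_smooth : ContDiffOn ℝ (⊤ : ℕ∞) F {0}ᶜ)
    (hF_hom : ∀ (c : ℝ), 0 < c → ∀ y, F (c • y) = c * F y)
    (y : V) (hy : y ≠ 0) (v : V) :
    fundForm F y y v = (1 / 2) * fderiv ℝ (fun w => (F w) ^ 2) y v := by
  rw [fundForm_eq F hF_smooth y hy]
  have h1 := (sq_diff2 F hF_smooth y hy).hasFDerivAt.clm_apply (hasFDerivAt_id y)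
  have h2 := (sq_diff F hF_smooth y hy).hasFDerivAt.const_mul 2
  have h3 := h1.unique (h2.congr_of_eventuallyEq (by
    filter_upwards [isOpen_compl_singleton.mem_nhds hy] with z hz
    exact euler_id F hF_smooth hF_hom z hz))
  have h4 := congrArg (fun L => L v) h3
  simp at h4
  linarith

end helpers

theorem stmt_1 {V : Type*} [NormedAddCommGroup V] [NormedSpace ℝ V] [FiniteDimensional ℝ V]
    (F : V → ℝ)
    (hF_nonneg : ∀ y, 0 ≤ F y)
    (hF_pos : ∀ y : V, y ≠ 0 → 0 < F y)
    (hF_smooth : ContDiffOn ℝ (⊤ : ℕ∞) F {0}ᶜ)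
    (hF_hom : ∀ (c : ℝ), 0 < c → ∀ y, F (c • y) = c * F y)
    (hF_posdef : ∀ y : V, y ≠ 0 → ∀ v : V, v ≠ 0 → 0 < fundForm F y v v)
    (ξ : V →L[ℝ] ℝ) (hξ : ξ ≠ 0) :
    ∃! y : V, y ≠ 0 ∧ ∀ v : V, fundForm F y y v = ξ v := by
  have hpos : ∀ y : V, y ≠ 0 → (∀ v : V, fundForm F y y v = ξ v) → 0 < ξ y := by
    intro y hy h
    rw [← h y, fundForm_self F hF_smooth hF_hom y hy, euler_id F hF_smooth hF_hom y hy]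
    have := hF_pos y hy
    positivity
  have hF0 : F 0 = 0 := by
    have := hF_hom 2 (by norm_num) 0
    rw [smul_zero] at this; linarith
  apply existsUnique_of_exists_of_unique
  · obtain ⟨x0, hx0⟩ : ∃ x, 0 < ξ x := by
      obtain ⟨x, hx⟩ : ∃ x, ξ x ≠ 0 := by
        by_contra! h
        exact hξ (ContinuousLinearMap.ext h)
      rcases lt_or_gt_of_ne hx with h | h
      · exact ⟨-x, by simpa using h⟩
      · exact ⟨x, h⟩
    have hx0' : x0 ≠ 0 := by rintro rfl; simp at hx0
    have hhom : ∀ z : V, z ≠ 0 → ∃ s ∈ Metric.sphere (0 : V) 1, ξ s / F s = ξ z / F z := by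
      intro z hz
      have hn : 0 < ‖z‖ := norm_pos_iff.2 hz
      refine ⟨‖z‖⁻¹ • z, by simp [norm_smul, hn.ne'], ?_⟩
      rw [hF_hom _ (inv_pos.2 hn), map_smul, smul_eq_mul,
        mul_div_mul_left _ _ (inv_pos.2 hn).ne']
    have hne : ∀ s ∈ Metric.sphere (0 : V) 1, s ≠ 0 := by
      rintro s hs rfl; simp at hs
    obtain ⟨s0, hs0, hs0'⟩ := hhom x0 hx0'
    have : ProperSpace V := FiniteDimensional.proper ℝ V
    obtain ⟨y0, hy0, hmax⟩ := (isCompact_sphere (0 : V) 1).exists_isMaxOn ⟨s0, hs0⟩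
      (f := fun s => ξ s / F s)
      (ξ.continuous.continuousOn.div (hF_smooth.continuousOn.mono hne)
        (fun s hs => (hF_pos s (hne s hs)).ne'))
    have hy0n := hne y0 hy0
    have hFy0 := hF_pos y0 hy0n
    obtain ⟨k, hk⟩ : ∃ k, k = ξ y0 / F y0 := ⟨_, rfl⟩
    have hbd : ∀ z, ξ z ≤ k * F z := by
      intro z
      by_cases hz : z = 0
      · simp [hz, hF0]
      · obtain ⟨s, hs, hs'⟩ := hhom z hz
        rw [← div_le_iff₀ (hF_pos z hz), ← hs', hk]
        exact hmax hs
    have hkpos : 0 < k := by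
      have h1 := hbd x0
      have h2 := hF_pos x0 hx0'
      by_contra! h
      nlinarith
    have hc : 0 < k / F y0 := by positivity
    have hξy0 : ξ y0 = k * F y0 := by rw [hk]; field_simp
    obtain ⟨y, hy⟩ : ∃ y, y = (k / F y0) • y0 := ⟨_, rfl⟩
    have hyn : y ≠ 0 := by rw [hy]; exact smul_ne_zero hc.ne' hy0n
    have hFy : F y = k := by rw [hy, hF_hom _ hc]; field_simp
    have hξy : ξ y = k ^ 2 := by rw [hy, map_smul, smul_eq_mul, hξy0]; field_simp
    refine ⟨y, hyn, fun v => ?_⟩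
    have hmin : IsLocalMin (fun z => F z ^ 2 - 2 * ξ z) y := by
      refine Filter.Eventually.of_forall fun z => ?_
      simp only [hFy, hξy]
      nlinarith [hbd z, sq_nonneg (F z - k)]
    have hd := (sq_diff F hF_smooth y hyn).hasFDerivAt.sub (ξ.hasFDerivAt.const_mul 2)
    have h0 := congrArg (fun L => L v) (hmin.hasFDerivAt_eq_zero hd)
    simp at h0
    rw [fundForm_self F hF_smooth hF_hom y hyn]
    linarith
  · rintro y z ⟨hy, hy'⟩ ⟨hz, hz'⟩
    by_contra hne
    have hdne : z - y ≠ 0 := sub_ne_zero.2 (Ne.symm hne)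
    have hseg : ∀ t ∈ Icc (0 : ℝ) 1, y + t • (z - y) ≠ 0 := by
      intro t ht h
      have h1 := congrArg ξ h
      simp at h1
      have := hpos y hy hy'
      have := hpos z hz hz'
      nlinarith [ht.1, ht.2, mul_nonneg ht.1 (hpos z hz hz').le,
        mul_nonneg (sub_nonneg.2 ht.2) (hpos y hy hy').le]
    have hder : ∀ t ∈ Icc (0 : ℝ) 1,
        HasDerivAt (fun t : ℝ => fderiv ℝ (fun w => (F w) ^ 2) (y + t • (z - y)) (z - y))
          (2 * fundForm F (y + t • (z - y)) (z - y) (z - y)) t := by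
      intro t ht
      have h1 : HasDerivAt (fun t : ℝ => y + t • (z - y)) (z - y) t := by
        simpa using ((hasDerivAt_id t).smul_const (z - y)).const_add y
      have h2 := (sq_diff2 F hF_smooth _ (hseg t ht)).hasFDerivAt.comp_hasDerivAt t h1
      have h3 := h2.clm_apply (hasDerivAt_const t (z - y))
      rw [fundForm_eq F hF_smooth _ (hseg t ht)]
      simpa using h3
    obtain ⟨t, ht, h⟩ := exists_hasDerivAt_eq_zero (zero_lt_one (α := ℝ))
      (fun t ht => (hder t ht).continuousAt.continuousWithinAt) (by
        have h1 := fundForm_self F hF_smooth hF_hom y hy (z - y)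
        have h2 := fundForm_self F hF_smooth hF_hom z hz (z - y)
        rw [hy'] at h1
        rw [hz'] at h2
        simp only [zero_smul, one_smul, add_zero, add_sub_cancel]
        linarith) (fun t ht => hder t (Ioo_subset_Icc_self ht))
    have := hF_posdef _ (hseg t (Ioo_subset_Icc_self ht)) _ hdne
    linarith
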